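/- Assume ρ ∈ (0,1) and σx < σy. If a = (x1, y1) ∈ ℝ² satisfies x1² + y1² = 2c² and a ≠ a*, then K(a, b*) > 0. In other words, the only point on the circle of radius √2·c centered at the origin at which the payoff against b* is ≤ 0 is a* = (−c, −c). -/

import Mathlib

open MeasureTheory ProbabilityTheory Real

/-- The bivariate normal measure on ℝ × ℝ with mean (0,0), standard deviations
`sx, sy` and correlation `ρ`, realized as the pushforward of two independent
standard gaussians. -/
noncomputable def binormal (sx sy ρ : ℝ) : Measure (ℝ × ℝ) :=
  Measure.map (fun z : ℝ × ℝ => (sx * z.1, sy * (ρ * z.1 + Real.sqrt (1 - ρ ^ 2) * z.2)))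
    ((gaussianReal 0 1).prod (gaussianReal 0 1))

/-- The set of points strictly closer (in Euclidean distance) to `a` than to `b`. -/
def closerTo (a b : ℝ × ℝ) : Set (ℝ × ℝ) :=
  {p | (p.1 - a.1) ^ 2 + (p.2 - a.2) ^ 2 < (p.1 - b.1) ^ 2 + (p.2 - b.2) ^ 2}

/-- The expected payoff (from Player I to Player II) when Player I offers `a`
and Player II offers `b`. -/
noncomputable def K (sx sy ρ : ℝ) (a b : ℝ × ℝ) : ℝ :=
  if a = b then a.1 + a.2
  else (a.1 + a.2) * ((binormal sx sy ρ) (closerTo a b)).toReal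
    + (b.1 + b.2) * ((binormal sx sy ρ) (closerTo b a)).toReal

/-- The common optimal offer magnitude. -/
noncomputable def cstar (sx sy ρ : ℝ) : ℝ :=
  Real.sqrt (2 * Real.pi * (sx ^ 2 + 2 * ρ * sx * sy + sy ^ 2)) / 4

instance isOpenPosMeasure_gaussianReal (μ : ℝ) {v : NNReal} [NeZero v] :
    (gaussianReal μ v).IsOpenPosMeasure :=
  (gaussianReal_absolutelyContinuous' μ (NeZero.ne v)).isOpenPosMeasure

/-- The standard gaussian measure on the plane is invariant under the central symmetry. -/
lemma map_neg_prod_gaussianReal (v w : NNReal) :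
    ((gaussianReal 0 v).prod (gaussianReal 0 w)).map (fun z : ℝ × ℝ => -z) =
      (gaussianReal 0 v).prod (gaussianReal 0 w) := by
  have h := Measure.map_prod_map (gaussianReal 0 v) (gaussianReal 0 w)
    (measurable_neg (G := ℝ)) (measurable_neg (G := ℝ))
  have hneg (u : NNReal) : (gaussianReal 0 u).map Neg.neg = gaussianReal 0 u := by
    simpa using gaussianReal_map_neg (μ := 0) (v := u)
  rw [hneg, hneg] at h
  exact h.symm

lemma isOpen_closerTo (a b : ℝ × ℝ) : IsOpen (closerTo a b) :=
  isOpen_lt (by fun_prop) (by fun_prop)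

lemma self_mem_closerTo {a b : ℝ × ℝ} (h : a ≠ b) : a ∈ closerTo a b := by
  have hne : a.1 - b.1 ≠ 0 ∨ a.2 - b.2 ≠ 0 := by
    by_contra! h'
    exact h (Prod.ext (sub_eq_zero.mp h'.1) (sub_eq_zero.mp h'.2))
  simp only [closerTo, Set.mem_ofPred_eq, sub_self]
  rcases hne with h' | h' <;>
    linarith [sq_pos_of_ne_zero h', sq_nonneg (a.1 - b.1), sq_nonneg (a.2 - b.2)]

/-- The perpendicular bisector of two points at the same distance from the origin passes through
the origin, so the central symmetry exchanges its two sides. -/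
lemma neg_mem_closerTo_iff {a b : ℝ × ℝ} (h : a.1 ^ 2 + a.2 ^ 2 = b.1 ^ 2 + b.2 ^ 2)
    (p : ℝ × ℝ) : -p ∈ closerTo a b ↔ p ∈ closerTo b a := by
  simp only [closerTo, Set.mem_ofPred_eq, Prod.fst_neg, Prod.snd_neg]
  constructor <;> intro h' <;> nlinarith

lemma measurable_binormal_map (sx sy ρ : ℝ) :
    Measurable (fun z : ℝ × ℝ => (sx * z.1, sy * (ρ * z.1 + √(1 - ρ ^ 2) * z.2))) := by
  fun_prop

instance isProbabilityMeasure_binormal (sx sy ρ : ℝ) :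
    IsProbabilityMeasure (binormal sx sy ρ) :=
  Measure.isProbabilityMeasure_map (measurable_binormal_map sx sy ρ).aemeasurable

lemma map_neg_binormal (sx sy ρ : ℝ) :
    (binormal sx sy ρ).map (fun p : ℝ × ℝ => -p) = binormal sx sy ρ := by
  have hm := measurable_binormal_map sx sy ρ
  conv_rhs => rw [binormal, ← map_neg_prod_gaussianReal]
  rw [binormal, Measure.map_map measurable_neg hm, Measure.map_map hm measurable_neg]
  congr 1
  ext z <;> simp only [Function.comp_apply, Prod.fst_neg, Prod.snd_neg] <;> ring

lemma isOpenPosMeasure_binormal {sx sy ρ : ℝ} (hsx : sx ≠ 0) (hsy : sy ≠ 0) (hρ : ρ ^ 2 < 1) :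
    (binormal sx sy ρ).IsOpenPosMeasure := by
  have hr : √(1 - ρ ^ 2) ≠ 0 := (Real.sqrt_pos.mpr (by linarith)).ne'
  refine Continuous.isOpenPosMeasure_map (by fun_prop) fun p => ?_
  refine ⟨(p.1 / sx, (p.2 / sy - ρ * (p.1 / sx)) / √(1 - ρ ^ 2)), Prod.ext ?_ ?_⟩
  · field_simp
  · field_simp
    ring

lemma binormal_closerTo_comm (sx sy ρ : ℝ) {a b : ℝ × ℝ}
    (h : a.1 ^ 2 + a.2 ^ 2 = b.1 ^ 2 + b.2 ^ 2) :
    binormal sx sy ρ (closerTo a b) = binormal sx sy ρ (closerTo b a) := by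
  conv_lhs => rw [← map_neg_binormal]
  rw [Measure.map_apply measurable_neg (isOpen_closerTo a b).measurableSet]
  exact congrArg _ (Set.ext (neg_mem_closerTo_iff h))

lemma cstar_pos {sx sy ρ : ℝ} (hsx : 0 < sx) (hsy : 0 < sy) (hρ : 0 < ρ) :
    0 < cstar sx sy ρ := by
  unfold cstar
  positivity

theorem positive_on_circle (sx sy ρ : ℝ) (hsx : 0 < sx) (hsy : 0 < sy)
    (hρ : ρ ∈ Set.Ioo (0 : ℝ) 1) (hσ : sx < sy) (a : ℝ × ℝ)
    (hcirc : a.1 ^ 2 + a.2 ^ 2 = 2 * (cstar sx sy ρ) ^ 2)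
    (ha : a ≠ ((-cstar sx sy ρ, -cstar sx sy ρ) : ℝ × ℝ)) :
    0 < K sx sy ρ a ((cstar sx sy ρ, cstar sx sy ρ) : ℝ × ℝ) := by
  obtain ⟨hρ0, hρ1⟩ := hρ
  have hc := cstar_pos hsx hsy hρ0
  set c := cstar sx sy ρ
  unfold K
  split_ifs with hab
  · rw [hab]
    exact add_pos hc hc
  · rw [binormal_closerTo_comm sx sy ρ (a := a) (b := (c, c)) (by simp only; linarith), ← add_mul]
    have := isOpenPosMeasure_binormal hsx.ne' hsy.ne' (by nlinarith : ρ ^ 2 < 1)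
    refine mul_pos ?_ (ENNReal.toReal_pos ?_ (measure_ne_top _ _))
    · by_contra! hle
      simp only at hle
      have h1 : a.1 + a.2 = -(2 * c) := by
        nlinarith [sq_nonneg (a.1 - a.2)]
      have h2 : a.1 = a.2 := by
        nlinarith [sq_nonneg (a.1 - a.2)]
      exact ha (Prod.ext (by simp only; linarith) (by simp only; linarith))
    · exact ((isOpen_closerTo _ _).measure_pos _
        ⟨_, self_mem_closerTo (Ne.symm hab)⟩).ne'
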